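/- Consider the discrete vector-valued unbalanced L¹ transport problem on a finite Cartesian grid G, solved via the SDMM algorithm applied to the dual formulation, with penalty parameter τ > 0. Let z = (z_i) be the limit of the SDMM dual variables (which exists by SDMM convergence theory). Then: (i) in the case q = 1 (operators L₁ = Id, L₂ = ∇_X, L₃ = (1/λ)Id and f₁(u) = −⟨u, ν−μ⟩_X, f₂ = indicator of {|w|_{X^d,∞} ≤ 1}, f₃ = indicator of {|u|_{X,∞} ≤ 1}), one has z₁ = τ(μ−ν), z₂ = τσ, z₃ = τλδ, where (σ, δ) solves min{ |σ|_{X^d,1} + λ|δ|_{X,1} : div_X(σ) = μ−ν+δ }; (ii) in the case q = 2 (L₁ = Id, L₂ = ∇_X and f₁(u) = −⟨u, ν−μ⟩_X + (1/(2λ))|u|²_{X,2}, f₂ = indicator of {|w|_{X^d,∞} ≤ 1}), one has z₁ = τ(μ−ν+δ), z₂ = τσ, where (σ, δ) solves min{ |σ|_{X^d,1} + (λ/2)|δ|²_{X,2} : div_X(σ) = μ−ν+δ }. -/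

import Mathlib

open scoped RealInnerProductSpace

noncomputable section

variable {V : Type*} [NormedAddCommGroup V] [InnerProductSpace ℝ V]
  [FiniteDimensional ℝ V]
variable {Nx Ny : ℕ}

/-- Discrete inner product `⟨u,v⟩_X = h_x h_y ∑ ⟨u_{ij}, v_{ij}⟩_V` on
`F(G;V)`. -/
def ipX (hx hy : ℝ) (u v : Fin Nx × Fin Ny → V) : ℝ :=
  hx * hy * ∑ p, ⟪u p, v p⟫

/-- Discrete inner product on `F(G;V^d)` (`d = 2`, Frobenius pairing). -/
def ipXd (hx hy : ℝ) (w z : Fin Nx × Fin Ny → V × V) : ℝ :=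
  hx * hy * ∑ p, (⟪(w p).1, (z p).1⟫ + ⟪(w p).2, (z p).2⟫)

/-- Frobenius norm on `V^d = V × V` (`d = 2`). -/
def fnrm (a : V × V) : ℝ := Real.sqrt (‖a.1‖ ^ 2 + ‖a.2‖ ^ 2)

/-- Discrete `l¹` norm `|u|_{X,1}` on `F(G;V)`. -/
def n1X (hx hy : ℝ) (u : Fin Nx × Fin Ny → V) : ℝ := hx * hy * ∑ p, ‖u p‖

/-- Discrete `l¹` norm `|w|_{X^d,1}` on `F(G;V^d)` (Frobenius norm). -/
def n1Xd (hx hy : ℝ) (w : Fin Nx × Fin Ny → V × V) : ℝ :=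
  hx * hy * ∑ p, fnrm (w p)

/-- Discrete squared `l²` norm `|u|²_{X,2}` on `F(G;V)`. -/
def n2sqX (hx hy : ℝ) (u : Fin Nx × Fin Ny → V) : ℝ :=
  hx * hy * ∑ p, ‖u p‖ ^ 2

/-- Discrete squared `l²` norm `|w|²_{X^d,2}` on `F(G;V^d)`. -/
def n2sqXd (hx hy : ℝ) (w : Fin Nx × Fin Ny → V × V) : ℝ :=
  hx * hy * ∑ p, (‖(w p).1‖ ^ 2 + ‖(w p).2‖ ^ 2)

/-- Successor index with the Neumann convention `u_{N+1} = u_N`. -/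
def fnext {N : ℕ} (i : Fin N) : Fin N :=
  if h : (i : ℕ) + 1 < N then ⟨(i : ℕ) + 1, h⟩ else i

/-- Forward finite-difference discrete gradient
`(∇_X u)_{ij} = ((u_{i+1,j}-u_{ij})/h_x, (u_{i,j+1}-u_{ij})/h_y)`. -/
def gradX (hx hy : ℝ) (u : Fin Nx × Fin Ny → V) (p : Fin Nx × Fin Ny) :
    V × V :=
  (hx⁻¹ • (u (fnext p.1, p.2) - u p), hy⁻¹ • (u (p.1, fnext p.2) - u p))

/-- The discrete divergence constraint `div_X σ = r`, expressed through the
defining duality `⟨div_X σ, u⟩_X = -⟨σ, ∇_X u⟩_{X^d}` for all `u`. -/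
def DivC (hx hy : ℝ) (σ : Fin Nx × Fin Ny → V × V)
    (r : Fin Nx × Fin Ny → V) : Prop :=
  ∀ u : Fin Nx × Fin Ny → V, -(ipXd hx hy σ (gradX hx hy u)) = ipX hx hy r u

/-- The dual function (valued in `EReal`) of the augmented problem
`min { Σᵢ fᵢ(yᵢ) : Lᵢφ = yᵢ }` for the case `q = 1`:
`L₁ = Id`, `L₂ = ∇_X`, `L₃ = (1/λ)Id`, `f₁(y₁) = -⟨y₁, ν-μ⟩_X`,
`f₂ = i_{|·|_{X^d,∞} ≤ 1}`, `f₃ = i_{|·|_{X,∞} ≤ 1}`: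
`g(z) = inf_{φ, y} Σᵢ fᵢ(yᵢ) + Σᵢ ⟨zᵢ, Lᵢφ - yᵢ⟩`. -/
def dualFn1 (hx hy lam : ℝ) (μ ν : Fin Nx × Fin Ny → V)
    (z₁ : Fin Nx × Fin Ny → V) (z₂ : Fin Nx × Fin Ny → V × V)
    (z₃ : Fin Nx × Fin Ny → V) : EReal :=
  ⨅ (φ : Fin Nx × Fin Ny → V) (y₁ : Fin Nx × Fin Ny → V)
    (y₂ : {w : Fin Nx × Fin Ny → V × V // ∀ p, fnrm (w p) ≤ 1})
    (y₃ : {u : Fin Nx × Fin Ny → V // ∀ p, ‖u p‖ ≤ 1}),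
    ((-(ipX hx hy y₁ (fun p => ν p - μ p)) +
        ipX hx hy z₁ (φ - y₁) +
        ipXd hx hy z₂ (gradX hx hy φ - y₂.1) +
        ipX hx hy z₃ (lam⁻¹ • φ - y₃.1) : ℝ) : EReal)

/-- The dual function of the augmented problem for the case `q = 2`:
`L₁ = Id`, `L₂ = ∇_X`, `f₁(y₁) = -⟨y₁, ν-μ⟩_X + (1/(2λ))|y₁|²_{X,2}`,
`f₂ = i_{|·|_{X^d,∞} ≤ 1}`. -/
def dualFn2 (hx hy lam : ℝ) (μ ν : Fin Nx × Fin Ny → V)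
    (z₁ : Fin Nx × Fin Ny → V) (z₂ : Fin Nx × Fin Ny → V × V) : EReal :=
  ⨅ (φ : Fin Nx × Fin Ny → V) (y₁ : Fin Nx × Fin Ny → V)
    (y₂ : {w : Fin Nx × Fin Ny → V × V // ∀ p, fnrm (w p) ≤ 1}),
    ((-(ipX hx hy y₁ (fun p => ν p - μ p)) +
        1 / (2 * lam) * n2sqX hx hy y₁ +
        ipX hx hy z₁ (φ - y₁) +
        ipXd hx hy z₂ (gradX hx hy φ - y₂.1) : ℝ) : EReal)


set_option linter.unusedSectionVars false

lemma aux_ipX_comm (hx hy : ℝ) (u v : Fin Nx × Fin Ny → V) :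
    ipX hx hy u v = ipX hx hy v u := by
  simp only [ipX]
  congr 1
  exact Finset.sum_congr rfl fun p _ => real_inner_comm _ _

lemma aux_ipX_add (hx hy : ℝ) (u v w : Fin Nx × Fin Ny → V) :
    ipX hx hy u (v + w) = ipX hx hy u v + ipX hx hy u w := by
  simp only [ipX, Pi.add_apply, inner_add_right, Finset.sum_add_distrib, mul_add]

lemma aux_ipX_sub (hx hy : ℝ) (u v w : Fin Nx × Fin Ny → V) :
    ipX hx hy u (v - w) = ipX hx hy u v - ipX hx hy u w := by
  simp only [ipX, Pi.sub_apply, inner_sub_right, Finset.sum_sub_distrib, mul_sub]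

lemma aux_ipX_smul (hx hy t : ℝ) (u v : Fin Nx × Fin Ny → V) :
    ipX hx hy u (t • v) = t * ipX hx hy u v := by
  simp only [ipX, Pi.smul_apply, inner_smul_right, ← Finset.mul_sum]
  ring

lemma aux_ipX_zero (hx hy : ℝ) (u : Fin Nx × Fin Ny → V) :
    ipX hx hy u 0 = 0 := by
  simp [ipX]

lemma aux_ipXd_sub (hx hy : ℝ) (u v w : Fin Nx × Fin Ny → V × V) :
    ipXd hx hy u (v - w) = ipXd hx hy u v - ipXd hx hy u w := by
  simp only [ipXd, Pi.sub_apply, Prod.fst_sub, Prod.snd_sub, inner_sub_right,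
    Finset.sum_sub_distrib, Finset.sum_add_distrib]
  ring

lemma aux_ipXd_smul (hx hy t : ℝ) (u v : Fin Nx × Fin Ny → V × V) :
    ipXd hx hy u (t • v) = t * ipXd hx hy u v := by
  simp only [ipXd, Pi.smul_apply, Prod.smul_fst, Prod.smul_snd, inner_smul_right,
    ← mul_add, ← Finset.mul_sum]
  ring

lemma aux_ipXd_zero (hx hy : ℝ) (u : Fin Nx × Fin Ny → V × V) :
    ipXd hx hy u 0 = 0 := by
  simp [ipXd]

lemma aux_grad_smul (hx hy t : ℝ) (u : Fin Nx × Fin Ny → V) :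
    gradX hx hy (t • u) = t • gradX hx hy u := by
  funext p
  simp only [gradX, Pi.smul_apply, Prod.smul_mk, ← smul_sub, smul_comm t]

lemma aux_grad_zero (hx hy : ℝ) :
    gradX hx hy (0 : Fin Nx × Fin Ny → V) = 0 := by
  funext p
  simp [gradX]

lemma aux_ipX_self (hx hy : ℝ) (u : Fin Nx × Fin Ny → V) :
    ipX hx hy u u = n2sqX hx hy u := by
  simp [ipX, n2sqX]

lemma aux_ipX_def {hx hy : ℝ} (hhx : 0 < hx) (hhy : 0 < hy)
    {u : Fin Nx × Fin Ny → V} (h : ipX hx hy u u = 0) : u = 0 := by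
  rw [aux_ipX_self, n2sqX] at h
  have h2 := (mul_eq_zero.1 h).resolve_left (by positivity)
  rw [Finset.sum_eq_zero_iff_of_nonneg (fun _ _ => by positivity)] at h2
  funext p
  simpa using h2 p (Finset.mem_univ p)

lemma aux_lin {c a l : ℝ} (h : ∀ t : ℝ, c ≤ a + t * l) : l = 0 := by
  by_contra hl
  have := h ((c - a - 1) / l)
  rw [div_mul_cancel₀ _ hl] at this
  linarith

lemma aux_fnrm_zero : fnrm (0 : V × V) = 0 := by simp [fnrm]

lemma aux_fnrm_smul (t : ℝ) (a : V × V) : fnrm (t • a) = |t| * fnrm a := by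
  simp only [fnrm, Prod.smul_fst, Prod.smul_snd, norm_smul, mul_pow, ← mul_add,
    Real.norm_eq_abs]
  rw [Real.sqrt_mul (by positivity), Real.sqrt_sq (abs_nonneg t)]

lemma aux_fnrm_sq (a : V × V) : fnrm a ^ 2 = ‖a.1‖ ^ 2 + ‖a.2‖ ^ 2 :=
  Real.sq_sqrt (by positivity)

lemma aux_fnrm_nonneg (a : V × V) : 0 ≤ fnrm a := Real.sqrt_nonneg _

lemma aux_cs (a b : V × V) : ⟪a.1, b.1⟫ + ⟪a.2, b.2⟫ ≤ fnrm a * fnrm b := by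
  have h1 := real_inner_le_norm a.1 b.1
  have h2 := real_inner_le_norm a.2 b.2
  refine (add_le_add h1 h2).trans (abs_le_of_sq_le_sq' ?_ ?_).2
  · rw [mul_pow, aux_fnrm_sq, aux_fnrm_sq]
    nlinarith [sq_nonneg (‖a.1‖ * ‖b.2‖ - ‖a.2‖ * ‖b.1‖)]
  · exact mul_nonneg (aux_fnrm_nonneg _) (aux_fnrm_nonneg _)

lemma aux_ipX_le {hx hy : ℝ} (hhx : 0 < hx) (hhy : 0 < hy)
    (u y : Fin Nx × Fin Ny → V) (hy1 : ∀ p, ‖y p‖ ≤ 1) :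
    ipX hx hy u y ≤ n1X hx hy u := by
  refine mul_le_mul_of_nonneg_left (Finset.sum_le_sum fun p _ => ?_) (by positivity)
  exact (real_inner_le_norm _ _).trans (mul_le_of_le_one_right (norm_nonneg _) (hy1 p))

lemma aux_ipXd_le {hx hy : ℝ} (hhx : 0 < hx) (hhy : 0 < hy)
    (u y : Fin Nx × Fin Ny → V × V) (hy1 : ∀ p, fnrm (y p) ≤ 1) :
    ipXd hx hy u y ≤ n1Xd hx hy u := by
  refine mul_le_mul_of_nonneg_left (Finset.sum_le_sum fun p _ => ?_) (by positivity)
  exact (aux_cs _ _).trans (mul_le_of_le_one_right (aux_fnrm_nonneg _) (hy1 p))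

lemma aux_inv {a : ℝ} (ha : 0 ≤ a) : |a⁻¹| * a ≤ 1 := by
  rw [abs_of_nonneg (inv_nonneg.2 ha)]
  exact inv_mul_le_one

lemma aux_ipX_att (hx hy : ℝ) (u : Fin Nx × Fin Ny → V) :
    ∃ y : Fin Nx × Fin Ny → V, (∀ p, ‖y p‖ ≤ 1) ∧ ipX hx hy u y = n1X hx hy u := by
  refine ⟨fun p => ‖u p‖⁻¹ • u p, fun p => ?_, ?_⟩
  · rw [norm_smul, Real.norm_eq_abs]
    exact aux_inv (norm_nonneg _)
  · simp only [ipX, n1X]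
    congr 1
    refine Finset.sum_congr rfl fun p _ => ?_
    rw [inner_smul_right, real_inner_self_eq_norm_sq]
    by_cases h : ‖u p‖ = 0
    · simp [h]
    · field_simp

lemma aux_ipXd_att (hx hy : ℝ) (u : Fin Nx × Fin Ny → V × V) :
    ∃ y : Fin Nx × Fin Ny → V × V,
      (∀ p, fnrm (y p) ≤ 1) ∧ ipXd hx hy u y = n1Xd hx hy u := by
  refine ⟨fun p => (fnrm (u p))⁻¹ • u p, fun p => ?_, ?_⟩
  · rw [aux_fnrm_smul]
    exact aux_inv (aux_fnrm_nonneg _)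
  · simp only [ipXd, n1Xd]
    congr 1
    refine Finset.sum_congr rfl fun p _ => ?_
    rw [Prod.smul_fst, Prod.smul_snd, inner_smul_right, inner_smul_right,
      real_inner_self_eq_norm_sq, real_inner_self_eq_norm_sq, ← mul_add, ← aux_fnrm_sq]
    by_cases h : fnrm (u p) = 0
    · simp [h]
    · field_simp

lemma aux_n1X_smul (hx hy t : ℝ) (ht : 0 ≤ t) (u : Fin Nx × Fin Ny → V) :
    n1X hx hy (t • u) = t * n1X hx hy u := by
  simp only [n1X, Pi.smul_apply, norm_smul, Real.norm_eq_abs, abs_of_nonneg ht,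
    ← Finset.mul_sum]
  ring

lemma aux_lower1 {hx hy lam : ℝ} (hhx : 0 < hx) (hhy : 0 < hy) (hlam : 0 < lam)
    (μ ν : Fin Nx × Fin Ny → V) (σ : Fin Nx × Fin Ny → V × V) (δ : Fin Nx × Fin Ny → V)
    (h : DivC hx hy σ (fun p => μ p - ν p + δ p)) :
    ((-(n1Xd hx hy σ + lam * n1X hx hy δ) : ℝ) : EReal) ≤
      dualFn1 hx hy lam μ ν (μ - ν) σ (lam • δ) := by
  refine le_iInf fun φ => le_iInf fun y₁ => le_iInf fun y₂ => le_iInf fun y₃ => ?_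
  rw [EReal.coe_le_coe_iff]
  have h0 := h φ
  change _ = ipX hx hy (μ - ν + δ) φ at h0
  change _ ≤ -(ipX hx hy y₁ (ν - μ)) + _ + _ + _
  have h2 := aux_ipXd_le hhx hhy σ y₂.1 y₂.2
  have h3 := aux_ipX_le hhx hhy (lam • δ) y₃.1 y₃.2
  rw [aux_n1X_smul _ _ _ hlam.le] at h3
  have e1 : ipX hx hy (lam • δ) (lam⁻¹ • φ) = ipX hx hy δ φ := by
    rw [aux_ipX_smul, aux_ipX_comm, aux_ipX_smul, aux_ipX_comm]
    field_simp
  rw [aux_ipX_comm, aux_ipX_add, aux_ipX_comm _ _ φ, aux_ipX_comm _ _ φ] at h0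
  rw [aux_ipX_sub _ _ (μ - ν), aux_ipXd_sub, aux_ipX_sub _ _ (lam • δ), e1,
    aux_ipX_comm _ _ (μ - ν) y₁, ← neg_sub μ ν]
  have e2 : ipX hx hy y₁ (-(μ - ν)) = - ipX hx hy y₁ (μ - ν) := by
    rw [← neg_one_smul ℝ, aux_ipX_smul, neg_one_mul]
  rw [e2]
  linarith

lemma aux_upper1 {hx hy lam : ℝ} (hhx : 0 < hx) (hhy : 0 < hy)
    (μ ν : Fin Nx × Fin Ny → V) (w₁ : Fin Nx × Fin Ny → V) (w₂ : Fin Nx × Fin Ny → V × V)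
    (w₃ : Fin Nx × Fin Ny → V) (c : ℝ)
    (h : (c : EReal) ≤ dualFn1 hx hy lam μ ν w₁ w₂ w₃) :
    w₁ = μ - ν ∧ DivC hx hy w₂ (fun p => μ p - ν p + (lam⁻¹ • w₃) p) ∧
      c ≤ -(n1Xd hx hy w₂ + n1X hx hy w₃) := by
  simp only [dualFn1, le_iInf_iff, EReal.coe_le_coe_iff] at h
  change ∀ φ y₁ y₂ y₃, c ≤ -(ipX hx hy y₁ (ν - μ)) + _ + _ + _ at h
  have z2 : ∀ p, fnrm ((0 : Fin Nx × Fin Ny → V × V) p) ≤ 1 := fun p => by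
    simp [aux_fnrm_zero]
  have z3 : ∀ p, ‖(0 : Fin Nx × Fin Ny → V) p‖ ≤ 1 := fun p => by simp
  have hw1 : w₁ = μ - ν := by
    rw [← sub_eq_zero]
    apply aux_ipX_def hhx hhy
    apply neg_eq_zero.1
    refine aux_lin (c := c) (a := 0) fun t => ?_
    have := h 0 (t • (w₁ - (μ - ν))) ⟨0, z2⟩ ⟨0, z3⟩
    simp only [aux_grad_zero, smul_zero, sub_zero, zero_sub, aux_ipX_zero, aux_ipXd_zero,
      ← smul_neg, aux_ipX_smul] at this
    rw [aux_ipX_comm, aux_ipX_smul] at this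
    have e : ipX hx hy (w₁ - (μ - ν)) (w₁ - (μ - ν)) =
        ipX hx hy (ν - μ) (w₁ - (μ - ν)) + ipX hx hy w₁ (w₁ - (μ - ν)) := by
      rw [aux_ipX_comm _ _ (ν - μ), aux_ipX_comm _ _ w₁, ← aux_ipX_add]
      congr 1
      abel
    have e2 : ipX hx hy w₁ (-(w₁ - (μ - ν))) = - ipX hx hy w₁ (w₁ - (μ - ν)) := by
      rw [← neg_one_smul ℝ, aux_ipX_smul, neg_one_mul]
    rw [e2] at this
    rw [e]
    linarith
  refine ⟨hw1, fun u => ?_, ?_⟩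
  · change _ = ipX hx hy (μ - ν + lam⁻¹ • w₃) u
    have := aux_lin (c := c) (a := 0)
      (l := ipX hx hy w₁ u + ipXd hx hy w₂ (gradX hx hy u) + lam⁻¹ * ipX hx hy w₃ u)
      fun t => by
        have := h (t • u) 0 ⟨0, z2⟩ ⟨0, z3⟩
        simp only [sub_zero, aux_grad_smul, aux_ipX_smul, aux_ipXd_smul] at this
        rw [aux_ipX_comm _ _ 0, aux_ipX_zero] at this
        linarith
    rw [← hw1, aux_ipX_comm, aux_ipX_add, aux_ipX_smul, aux_ipX_comm, aux_ipX_comm _ _ u]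
    linarith
  · obtain ⟨y₂, hy2, e2⟩ := aux_ipXd_att hx hy w₂
    obtain ⟨y₃, hy3, e3⟩ := aux_ipX_att hx hy w₃
    have := h 0 0 ⟨y₂, hy2⟩ ⟨y₃, hy3⟩
    simp only [aux_ipX_sub, aux_ipXd_sub, aux_grad_zero, smul_zero, aux_ipX_zero,
      aux_ipXd_zero, e2, e3] at this
    rw [aux_ipX_comm _ _ 0 μ, aux_ipX_comm _ _ 0 ν, aux_ipX_zero, aux_ipX_zero] at this
    linarith

lemma aux_ipX_neg (hx hy : ℝ) (u v : Fin Nx × Fin Ny → V) :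
    ipX hx hy u (-v) = - ipX hx hy u v := by
  rw [← neg_one_smul ℝ, aux_ipX_smul, neg_one_mul]

lemma aux_lower2 {hx hy lam : ℝ} (hhx : 0 < hx) (hhy : 0 < hy) (hlam : 0 < lam)
    (μ ν : Fin Nx × Fin Ny → V) (σ : Fin Nx × Fin Ny → V × V) (δ : Fin Nx × Fin Ny → V)
    (h : DivC hx hy σ (fun p => μ p - ν p + δ p)) :
    ((-(n1Xd hx hy σ + lam / 2 * n2sqX hx hy δ) : ℝ) : EReal) ≤
      dualFn2 hx hy lam μ ν (μ - ν + δ) σ := by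
  refine le_iInf fun φ => le_iInf fun y₁ => le_iInf fun y₂ => ?_
  rw [EReal.coe_le_coe_iff]
  have h0 := h φ
  change _ = ipX hx hy (μ - ν + δ) φ at h0
  change _ ≤ -(ipX hx hy y₁ (ν - μ)) + _ + _ + _
  have h2 := aux_ipXd_le hhx hhy σ y₂.1 y₂.2
  have h3 : 0 ≤ ipX hx hy (y₁ - lam • δ) (y₁ - lam • δ) := by
    rw [aux_ipX_self, n2sqX]
    positivity
  have h4 : ipX hx hy (y₁ - lam • δ) (y₁ - lam • δ) =
      n2sqX hx hy y₁ - 2 * lam * ipX hx hy y₁ δ + lam ^ 2 * n2sqX hx hy δ := by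
    rw [aux_ipX_sub, aux_ipX_smul, aux_ipX_comm _ _ _ y₁, aux_ipX_comm _ _ _ δ,
      aux_ipX_sub, aux_ipX_sub, aux_ipX_smul, aux_ipX_smul, aux_ipX_self, aux_ipX_self,
      aux_ipX_comm _ _ δ y₁]
    ring
  rw [h4] at h3
  have h5 : 0 ≤ 1 / (2 * lam) * n2sqX hx hy y₁ - ipX hx hy y₁ δ
      + lam / 2 * n2sqX hx hy δ := by
    have : 1 / (2 * lam) * n2sqX hx hy y₁ - ipX hx hy y₁ δ + lam / 2 * n2sqX hx hy δ =
      1 / (2 * lam) * (n2sqX hx hy y₁ - 2 * lam * ipX hx hy y₁ δ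
        + lam ^ 2 * n2sqX hx hy δ) := by
      field_simp
    rw [this]
    positivity
  rw [aux_ipX_sub _ _ (μ - ν + δ), aux_ipXd_sub, aux_ipX_comm _ _ (μ - ν + δ) y₁, ← neg_sub μ ν,
    aux_ipX_neg, aux_ipX_add]
  linarith

lemma aux_upper2 {hx hy lam : ℝ} (hhx : 0 < hx) (hhy : 0 < hy) (hlam : 0 < lam)
    (μ ν : Fin Nx × Fin Ny → V) (w₁ : Fin Nx × Fin Ny → V) (w₂ : Fin Nx × Fin Ny → V × V)
    (c : ℝ) (h : (c : EReal) ≤ dualFn2 hx hy lam μ ν w₁ w₂) :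
    DivC hx hy w₂ w₁ ∧
      c ≤ -(n1Xd hx hy w₂ + lam / 2 * n2sqX hx hy (w₁ - (μ - ν))) := by
  simp only [dualFn2, le_iInf_iff, EReal.coe_le_coe_iff] at h
  change ∀ φ y₁ y₂, c ≤ -(ipX hx hy y₁ (ν - μ)) + _ + _ + _ at h
  have z2 : ∀ p, fnrm ((0 : Fin Nx × Fin Ny → V × V) p) ≤ 1 := fun p => by
    simp [aux_fnrm_zero]
  refine ⟨fun u => ?_, ?_⟩
  · have := aux_lin (c := c) (a := 0)
      (l := ipX hx hy w₁ u + ipXd hx hy w₂ (gradX hx hy u))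
      fun t => by
        have := h (t • u) 0 ⟨0, z2⟩
        simp only [sub_zero, aux_grad_smul, aux_ipX_smul, aux_ipXd_smul,
          ← aux_ipX_self] at this
        rw [aux_ipX_comm _ _ 0, aux_ipX_zero, aux_ipX_zero] at this
        linarith
    linarith
  · obtain ⟨y₂, hy2, e2⟩ := aux_ipXd_att hx hy w₂
    have := h 0 (lam • (w₁ - (μ - ν))) ⟨y₂, hy2⟩
    have e : ipX hx hy (w₁ - (μ - ν)) (w₁ - (μ - ν)) =
        ipX hx hy (ν - μ) (w₁ - (μ - ν)) + ipX hx hy w₁ (w₁ - (μ - ν)) := by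
      rw [aux_ipX_comm _ _ (ν - μ), aux_ipX_comm _ _ w₁, ← aux_ipX_add]
      congr 1
      abel
    rw [← aux_ipX_self, aux_ipX_comm _ _ _ (ν - μ), aux_ipX_smul, aux_ipX_smul,
      aux_ipX_comm _ _ (lam • (w₁ - (μ - ν))) (w₁ - (μ - ν)), zero_sub, aux_ipX_neg,
      aux_ipX_smul, aux_ipX_smul, aux_ipXd_sub, aux_grad_zero, aux_ipXd_zero, e2] at this
    rw [← aux_ipX_self]
    have e3 : 1 / (2 * lam) * (lam * (lam * ipX hx hy (w₁ - (μ - ν)) (w₁ - (μ - ν)))) =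
        lam / 2 * ipX hx hy (w₁ - (μ - ν)) (w₁ - (μ - ν)) := by
      field_simp
    rw [e3] at this
    have e4 := congrArg (lam * ·) e
    simp only [mul_add] at e4
    linarith

lemma aux_feas (hx hy : ℝ) (μ ν : Fin Nx × Fin Ny → V) :
    DivC hx hy 0 (fun p => μ p - ν p + (ν - μ) p) := by
  intro u
  simp [ipX, ipXd]

/-- relation between the limit SDMM dual variables and the
solution of the discrete Beckmann problem. If `z/τ` maximizes the dual
function of the augmented problem, then (i) for `q = 1`:
`z₁ = τ(μ-ν)`, `z₂ = τσ`, `z₃ = τλδ`, with `(σ,δ)` solving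
`min { |σ|_{X^d,1} + λ|δ|_{X,1} : div_X σ = μ-ν+δ }`; (ii) for `q = 2`:
`z₁ = τ(μ-ν+δ)`, `z₂ = τσ`, with `(σ,δ)` solving
`min { |σ|_{X^d,1} + (λ/2)|δ|²_{X,2} : div_X σ = μ-ν+δ }`. -/
theorem sdmm_dual_variables
    (hNx : 0 < Nx) (hNy : 0 < Ny) (hx hy : ℝ) (hhx : 0 < hx) (hhy : 0 < hy)
    (lam : ℝ) (hlam : 0 < lam) (τ : ℝ) (hτ : 0 < τ)
    (μ ν : Fin Nx × Fin Ny → V) :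
    -- (i) case q = 1
    (∀ (z₁ : Fin Nx × Fin Ny → V) (z₂ : Fin Nx × Fin Ny → V × V)
        (z₃ : Fin Nx × Fin Ny → V),
      (∀ (w₁ : Fin Nx × Fin Ny → V) (w₂ : Fin Nx × Fin Ny → V × V)
          (w₃ : Fin Nx × Fin Ny → V),
        dualFn1 hx hy lam μ ν w₁ w₂ w₃ ≤
          dualFn1 hx hy lam μ ν (τ⁻¹ • z₁) (τ⁻¹ • z₂) (τ⁻¹ • z₃)) →
      ∃ (σ : Fin Nx × Fin Ny → V × V) (δ : Fin Nx × Fin Ny → V),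
        DivC hx hy σ (fun p => μ p - ν p + δ p) ∧
        (∀ (σ' : Fin Nx × Fin Ny → V × V) (δ' : Fin Nx × Fin Ny → V),
          DivC hx hy σ' (fun p => μ p - ν p + δ' p) →
          n1Xd hx hy σ + lam * n1X hx hy δ ≤
            n1Xd hx hy σ' + lam * n1X hx hy δ') ∧
        z₁ = τ • (fun p => μ p - ν p) ∧ z₂ = τ • σ ∧
        z₃ = (τ * lam) • δ) ∧
    -- (ii) case q = 2
    (∀ (z₁ : Fin Nx × Fin Ny → V) (z₂ : Fin Nx × Fin Ny → V × V),
      (∀ (w₁ : Fin Nx × Fin Ny → V) (w₂ : Fin Nx × Fin Ny → V × V),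
        dualFn2 hx hy lam μ ν w₁ w₂ ≤
          dualFn2 hx hy lam μ ν (τ⁻¹ • z₁) (τ⁻¹ • z₂)) →
      ∃ (σ : Fin Nx × Fin Ny → V × V) (δ : Fin Nx × Fin Ny → V),
        DivC hx hy σ (fun p => μ p - ν p + δ p) ∧
        (∀ (σ' : Fin Nx × Fin Ny → V × V) (δ' : Fin Nx × Fin Ny → V),
          DivC hx hy σ' (fun p => μ p - ν p + δ' p) →
          n1Xd hx hy σ + lam / 2 * n2sqX hx hy δ ≤
            n1Xd hx hy σ' + lam / 2 * n2sqX hx hy δ') ∧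
        z₁ = τ • (fun p => μ p - ν p + δ p) ∧ z₂ = τ • σ) := by
  refine ⟨fun z₁ z₂ z₃ h => ?_, fun z₁ z₂ h => ?_⟩
  · have key := fun (σ' : Fin Nx × Fin Ny → V × V) (δ' : Fin Nx × Fin Ny → V)
        (hd : DivC hx hy σ' (fun p => μ p - ν p + δ' p)) =>
      aux_upper1 hhx hhy μ ν _ _ _ _
        ((aux_lower1 hhx hhy hlam μ ν σ' δ' hd).trans (h _ _ _))
    obtain ⟨a, b, -⟩ := key _ _ (aux_feas hx hy μ ν)
    refine ⟨τ⁻¹ • z₂, lam⁻¹ • τ⁻¹ • z₃, b, fun σ' δ' hd => ?_, ?_, ?_, ?_⟩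
    · have := (key σ' δ' hd).2.2
      rw [aux_n1X_smul _ _ lam⁻¹ (by positivity), mul_inv_cancel_left₀ hlam.ne']
      linarith
    · change z₁ = τ • (μ - ν)
      rw [← a, smul_inv_smul₀ hτ.ne']
    · rw [smul_inv_smul₀ hτ.ne']
    · rw [mul_smul, smul_inv_smul₀ hlam.ne', smul_inv_smul₀ hτ.ne']
  · have key := fun (σ' : Fin Nx × Fin Ny → V × V) (δ' : Fin Nx × Fin Ny → V)
        (hd : DivC hx hy σ' (fun p => μ p - ν p + δ' p)) =>
      aux_upper2 hhx hhy hlam μ ν _ _ _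
        ((aux_lower2 hhx hhy hlam μ ν σ' δ' hd).trans (h _ _))
    obtain ⟨b, -⟩ := key _ _ (aux_feas hx hy μ ν)
    have e : (fun p => μ p - ν p + (τ⁻¹ • z₁ - (μ - ν)) p) = τ⁻¹ • z₁ := by
      funext p
      simp
    refine ⟨τ⁻¹ • z₂, τ⁻¹ • z₁ - (μ - ν), ?_, fun σ' δ' hd => ?_, ?_, ?_⟩
    · rw [e]
      exact b
    · have := (key σ' δ' hd).2
      linarith
    · rw [e, smul_inv_smul₀ hτ.ne']
    · rw [smul_inv_smul₀ hτ.ne']
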